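/- Let $\gamma > 0$, $T > 2\pi/\gamma$, and $N_0 \in \mathbb{N}$. Let $(\mu_n)_{|n| \geq N_0}$ be complex numbers such that $\mathrm{Re}\,\mu_{n+1} - \mathrm{Re}\,\mu_n \geq \gamma$ for all $|n| \geq N_0$, and $\mathrm{Im}\,\mu_n \to 0$ as $|n| \to \infty$. Then there exist $M \geq N_0$ and constants $C, C_1 > 0$ depending on $T$ such that for every square-summable sequence $(\beta_n)_{|n| \geq M}$ of complex numbers, the function $g(t) = \sum_{|n| \geq M}\beta_n e^{i\mu_n t}$ satisfies $C\sum_{|n| \geq M}|\beta_n|^2 \leq \int_0^T |g(t)|^2\,dt \leq C_1\sum_{|n| \geq M}|\beta_n|^2$. -/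

import Mathlib

open Filter MeasureTheory

/-- The off-diagonal kernel `1 / (4k² - 1)` of Ingham's argument, set to `0` at `k = 0`. -/
noncomputable def inghamKernel (k : ℤ) : ℝ := if k = 0 then 0 else 1 / (4 * (k : ℝ) ^ 2 - 1)

lemma inghamKernel_neg (k : ℤ) : inghamKernel (-k) = inghamKernel k := by
  simp [inghamKernel]

lemma four_mul_sq_sub_one_pos {k : ℤ} (hk : k ≠ 0) : 0 < 4 * (k : ℝ) ^ 2 - 1 := by
  have h : (0 : ℤ) < k ^ 2 := by positivity
  have h1 : (1 : ℝ) ≤ (k : ℝ) ^ 2 := by exact_mod_cast h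
  linarith

lemma inghamKernel_nonneg (k : ℤ) : 0 ≤ inghamKernel k := by
  unfold inghamKernel
  split_ifs with h
  · exact le_rfl
  · exact (one_div_pos.2 (four_mul_sq_sub_one_pos h)).le

lemma hasSum_inghamKernel_nat_succ : HasSum (fun n : ℕ => inghamKernel ((n : ℤ) + 1)) (1 / 2) := by
  rw [hasSum_iff_tendsto_nat_of_nonneg (fun n => inghamKernel_nonneg _)]
  have hpartial : ∀ N : ℕ, ∑ n ∈ Finset.range N, inghamKernel ((n : ℤ) + 1)
      = 1 / 2 - 1 / 2 * (1 / (2 * (N : ℝ) + 1)) := by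
    intro N
    induction N with
    | zero => simp
    | succ N ih =>
      have h0 : ((N : ℤ) + 1) ≠ 0 := by omega
      have h1 : (4 * ((N : ℝ) + 1) ^ 2 - 1) ≠ 0 := by
        have := four_mul_sq_sub_one_pos h0
        push_cast at this
        exact this.ne'
      have h2 : (2 * (N : ℝ) + 1) ≠ 0 := by positivity
      have h3 : (2 * ((N : ℝ) + 1) + 1) ≠ 0 := by positivity
      rw [Finset.sum_range_succ, ih, inghamKernel, if_neg h0]
      push_cast
      field_simp
      ring
  simp_rw [hpartial]
  have h : Tendsto (fun N : ℕ => 1 / (2 * (N : ℝ) + 1)) atTop (nhds 0) := by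
    simp_rw [one_div]
    exact tendsto_inv_atTop_zero.comp (tendsto_atTop_add_const_right _ _
      (tendsto_natCast_atTop_atTop.const_mul_atTop two_pos))
  have h' := (h.const_mul (1 / 2)).const_sub (1 / 2)
  rwa [mul_zero, sub_zero] at h'

lemma hasSum_inghamKernel : HasSum inghamKernel 1 := by
  have h1 : HasSum (fun n : ℕ => inghamKernel (n : ℤ)) (1 / 2) := by
    rw [← hasSum_nat_add_iff' 1]
    simpa [inghamKernel] using hasSum_inghamKernel_nat_succ
  have h2 : HasSum (fun n : ℕ => inghamKernel (-((n : ℤ) + 1))) (1 / 2) := by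
    simpa only [inghamKernel_neg] using hasSum_inghamKernel_nat_succ
  have h := HasSum.of_nat_of_neg_add_one h1 h2
  rwa [add_halves] at h

/-- Schur's test for the convolution kernel `inghamKernel`. -/
lemma sum_sum_mul_inghamKernel_le (s : Finset ℤ) (b : ℤ → ℝ) :
    ∑ n ∈ s, ∑ m ∈ s, b n * b m * inghamKernel (n - m) ≤ ∑ n ∈ s, b n ^ 2 := by
  have hrow : ∀ n : ℤ, ∑ m ∈ s, inghamKernel (n - m) ≤ 1 := by
    intro n
    have h : HasSum (inghamKernel ∘ Equiv.subLeft n) 1 :=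
      (Equiv.hasSum_iff (Equiv.subLeft n)).2 hasSum_inghamKernel
    have h' := sum_le_hasSum s (fun m _ => inghamKernel_nonneg _) h
    simpa only [Function.comp_apply, Equiv.subLeft_apply] using h'
  have hhalf : ∑ n ∈ s, ∑ m ∈ s, b n ^ 2 * inghamKernel (n - m) ≤ ∑ n ∈ s, b n ^ 2 := by
    refine Finset.sum_le_sum fun n _ => ?_
    rw [← Finset.mul_sum]
    exact mul_le_of_le_one_right (sq_nonneg _) (hrow n)
  have hswap : ∑ n ∈ s, ∑ m ∈ s, b m ^ 2 * inghamKernel (n - m)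
      = ∑ n ∈ s, ∑ m ∈ s, b n ^ 2 * inghamKernel (n - m) := by
    rw [Finset.sum_comm]
    refine Finset.sum_congr rfl fun n _ => Finset.sum_congr rfl fun m _ => ?_
    rw [← inghamKernel_neg, neg_sub]
  have hle : ∑ n ∈ s, ∑ m ∈ s, b n * b m * inghamKernel (n - m)
      ≤ ∑ n ∈ s, ∑ m ∈ s, (1 / 2 * (b n ^ 2 * inghamKernel (n - m))
        + 1 / 2 * (b m ^ 2 * inghamKernel (n - m))) := by
    refine Finset.sum_le_sum fun n _ => Finset.sum_le_sum fun m _ => ?_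
    nlinarith [mul_nonneg (sq_nonneg (b n - b m)) (inghamKernel_nonneg (n - m))]
  simp only [Finset.sum_add_distrib, ← Finset.mul_sum] at hle hhalf hswap
  linarith

/-- The integral of `sin (a t) e^{iλt}` over a half period of `sin (a t)`. -/
lemma integral_sin_mul_cexp {S : ℝ} (hS : 0 < S) (l : ℂ) :
    ((Real.pi / S : ℝ) ^ 2 - l ^ 2) *
        ∫ t in (0 : ℝ)..S, (Real.sin (Real.pi / S * t) : ℂ) * Complex.exp (Complex.I * l * t)
      = (Real.pi / S : ℝ) * (1 + Complex.exp (Complex.I * l * S)) := by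
  set a : ℝ := Real.pi / S with ha
  have haS : a * S = Real.pi := by rw [ha]; field_simp
  have hderiv : ∀ t : ℝ, HasDerivAt (fun t : ℝ => Complex.exp (Complex.I * l * t) *
      (Complex.I * l * (Real.sin (a * t) : ℂ) - a * (Real.cos (a * t) : ℂ)))
      (((a : ℂ) ^ 2 - l ^ 2) * ((Real.sin (a * t) : ℂ) * Complex.exp (Complex.I * l * t))) t := by
    intro t
    have hat : HasDerivAt (fun t : ℝ => a * t) a t := by simpa using (hasDerivAt_id t).const_mul a
    have hs := ((Real.hasDerivAt_sin (a * t)).comp t hat).ofReal_comp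
    have hc := ((Real.hasDerivAt_cos (a * t)).comp t hat).ofReal_comp
    have he : HasDerivAt (fun t : ℝ => Complex.exp (Complex.I * l * t))
        (Complex.exp (Complex.I * l * t) * (Complex.I * l)) t := by
      simpa using ((Complex.ofRealCLM.hasDerivAt (x := t)).const_mul (Complex.I * l)).cexp
    have h := he.mul ((hs.const_mul (Complex.I * l)).sub (hc.const_mul (a : ℂ)))
    refine h.congr_deriv ?_
    simp only [Function.comp_apply, Pi.sub_apply]
    push_cast
    linear_combination (Complex.exp (Complex.I * l * t) * l ^ 2 * Complex.sin (a * t)) *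
      Complex.I_sq
  rw [← intervalIntegral.integral_const_mul,
    intervalIntegral.integral_eq_sub_of_hasDerivAt (fun t _ => hderiv t)
      (Continuous.intervalIntegrable (by fun_prop) _ _)]
  simp only [haS, Real.sin_pi, Real.cos_pi, Complex.ofReal_zero, mul_zero, Real.sin_zero,
    Real.cos_zero, Complex.exp_zero]
  push_cast
  ring

lemma norm_cexp_I_mul_le {l : ℂ} {d t S : ℝ} (hl : |l.im| ≤ d) (ht : 0 ≤ t) (htS : t ≤ S) :
    ‖Complex.exp (Complex.I * l * t)‖ ≤ Real.exp (d * S) := by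
  rw [Complex.norm_exp, Real.exp_le_exp]
  have : (Complex.I * l * t).re = -l.im * t := by simp
  rw [this]
  have h := abs_le.1 hl
  nlinarith [abs_nonneg l.im]

lemma norm_integral_sin_mul_cexp_le {S g d : ℝ} (hS : 0 < S) (hg : 2 * (Real.pi / S) < g)
    {l : ℂ} (hl : |l.im| ≤ d) {k : ℤ} (hk : k ≠ 0) (hre : g * |(k : ℝ)| ≤ |l.re|) :
    ‖∫ t in (0 : ℝ)..S, (Real.sin (Real.pi / S * t) : ℂ) * Complex.exp (Complex.I * l * t)‖
      ≤ Real.pi / S * (1 + Real.exp (d * S)) * (4 / g ^ 2) * inghamKernel k := by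
  have h := congrArg norm (integral_sin_mul_cexp hS l)
  set J := ∫ t in (0 : ℝ)..S, (Real.sin (Real.pi / S * t) : ℂ) * Complex.exp (Complex.I * l * t)
  have ha : 0 < Real.pi / S := div_pos Real.pi_pos hS
  set a : ℝ := Real.pi / S
  rw [norm_mul, norm_mul, Complex.norm_real, Real.norm_of_nonneg ha.le] at h
  have hnum : ‖1 + Complex.exp (Complex.I * l * S)‖ ≤ 1 + Real.exp (d * S) :=
    (norm_add_le _ _).trans (by
      rw [norm_one]; gcongr; exact norm_cexp_I_mul_le hl hS.le le_rfl)
  have hkpos := four_mul_sq_sub_one_pos hk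
  have hg0 : 0 < g := by linarith
  have hden : g ^ 2 / 4 * (4 * (k : ℝ) ^ 2 - 1) ≤ ‖(a : ℂ) ^ 2 - l ^ 2‖ := by
    have h1 : ‖l ^ 2‖ - ‖(a : ℂ) ^ 2‖ ≤ ‖(a : ℂ) ^ 2 - l ^ 2‖ := by
      rw [norm_sub_rev]; exact norm_sub_norm_le _ _
    rw [norm_pow, norm_pow, Complex.norm_real, Real.norm_of_nonneg ha.le] at h1
    have h2 : (g * |(k : ℝ)|) ^ 2 ≤ ‖l‖ ^ 2 := by
      gcongr
      exact hre.trans (Complex.abs_re_le_norm l)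
    rw [mul_pow, sq_abs] at h2
    nlinarith
  have hpos : 0 < g ^ 2 / 4 * (4 * (k : ℝ) ^ 2 - 1) := by positivity
  have hmul : g ^ 2 / 4 * (4 * (k : ℝ) ^ 2 - 1) * ‖J‖ ≤ a * (1 + Real.exp (d * S)) :=
    calc _ ≤ ‖(a : ℂ) ^ 2 - l ^ 2‖ * ‖J‖ := by gcongr
      _ = _ := h
      _ ≤ _ := by gcongr
  rw [inghamKernel, if_neg hk]
  calc ‖J‖ ≤ a * (1 + Real.exp (d * S)) / (g ^ 2 / 4 * (4 * (k : ℝ) ^ 2 - 1)) := by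
        rw [le_div_iff₀ hpos]; linarith
    _ = _ := by field_simp

/-- The diagonal terms of Ingham's quadratic form. -/
lemma integral_sin_mul_exp_mem {S d y : ℝ} (hS : 0 < S) (hy : |y| ≤ d) :
    2 / (Real.pi / S) * Real.exp (-(d * S))
        ≤ ∫ t in (0 : ℝ)..S, Real.sin (Real.pi / S * t) * Real.exp (y * t) ∧
      ∫ t in (0 : ℝ)..S, Real.sin (Real.pi / S * t) * Real.exp (y * t)
        ≤ 2 / (Real.pi / S) * Real.exp (d * S) := by
  have ha : 0 < Real.pi / S := div_pos Real.pi_pos hS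
  have haS : Real.pi / S * S = Real.pi := by field_simp
  set a : ℝ := Real.pi / S
  have hint : ∫ t in (0 : ℝ)..S, Real.sin (a * t) = 2 / a := by
    rw [intervalIntegral.integral_comp_mul_left _ ha.ne', haS, mul_zero, integral_sin]
    simp
    ring
  have hsin : ∀ t ∈ Set.Icc 0 S, 0 ≤ Real.sin (a * t) := fun t ht =>
    Real.sin_nonneg_of_nonneg_of_le_pi (mul_nonneg ha.le ht.1)
      (haS ▸ mul_le_mul_of_nonneg_left ht.2 ha.le)
  have hy' := abs_le.1 hy
  rw [← hint, ← intervalIntegral.integral_mul_const, ← intervalIntegral.integral_mul_const]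
  constructor <;>
  · refine intervalIntegral.integral_mono_on hS.le (Continuous.intervalIntegrable (by fun_prop) _ _)
      (Continuous.intervalIntegrable (by fun_prop) _ _) fun t ht => ?_
    refine mul_le_mul_of_nonneg_left (Real.exp_le_exp.2 ?_) (hsin t ht)
    nlinarith [ht.1, ht.2, abs_nonneg y]

lemma normSq_sum_cexp (s : Finset ℤ) (μ β : ℤ → ℂ) (t : ℝ) :
    ((‖∑ n ∈ s, β n * Complex.exp (Complex.I * μ n * t)‖ ^ 2 : ℝ) : ℂ)
      = ∑ n ∈ s, ∑ m ∈ s, β n * (starRingEnd ℂ) (β m) *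
          Complex.exp (Complex.I * (μ n - (starRingEnd ℂ) (μ m)) * t) := by
  rw [Complex.ofReal_pow, ← Complex.mul_conj', map_sum, Finset.sum_mul_sum]
  refine Finset.sum_congr rfl fun n _ => Finset.sum_congr rfl fun m _ => ?_
  rw [map_mul, ← Complex.exp_conj, map_mul, map_mul, Complex.conj_I, Complex.conj_ofReal,
    mul_mul_mul_comm, ← Complex.exp_add]
  ring_nf

/-- The weighted `L²` norm of a finite exponential sum as a quadratic form in its coefficients. -/
lemma integral_sin_mul_normSq_sum_cexp (S : ℝ) (s : Finset ℤ) (μ β : ℤ → ℂ) :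
    ((∫ t in (0 : ℝ)..S, Real.sin (Real.pi / S * t) *
        ‖∑ n ∈ s, β n * Complex.exp (Complex.I * μ n * t)‖ ^ 2 : ℝ) : ℂ)
      = ∑ n ∈ s, ∑ m ∈ s, β n * (starRingEnd ℂ) (β m) *
          ∫ t in (0 : ℝ)..S, (Real.sin (Real.pi / S * t) : ℂ) *
            Complex.exp (Complex.I * (μ n - (starRingEnd ℂ) (μ m)) * t) := by
  rw [← intervalIntegral.integral_ofReal]
  simp_rw [Complex.ofReal_mul, normSq_sum_cexp, Finset.mul_sum]
  rw [intervalIntegral.integral_finsetSum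
    (fun n _ => Continuous.intervalIntegrable (by fun_prop) _ _)]
  refine Finset.sum_congr rfl fun n _ => ?_
  rw [intervalIntegral.integral_finsetSum
    (fun m _ => Continuous.intervalIntegrable (by fun_prop) _ _)]
  refine Finset.sum_congr rfl fun m _ => ?_
  rw [← intervalIntegral.integral_const_mul]
  congr 1
  ext t
  ring

/-- Two-sided weighted Ingham inequality for finite exponential sums. -/
lemma ingham_weighted {S g d : ℝ} (hS : 0 < S) (hg : 2 * (Real.pi / S) < g)
    (s : Finset ℤ) (μ β : ℤ → ℂ) (him : ∀ n ∈ s, |(μ n).im| ≤ d)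
    (hre : ∀ n ∈ s, ∀ m ∈ s, g * |((n - m : ℤ) : ℝ)| ≤ |(μ n).re - (μ m).re|) :
    (2 / (Real.pi / S) * Real.exp (-(2 * d * S))
        - Real.pi / S * (1 + Real.exp (2 * d * S)) * (4 / g ^ 2)) * ∑ n ∈ s, ‖β n‖ ^ 2
      ≤ ∫ t in (0 : ℝ)..S, Real.sin (Real.pi / S * t) *
        ‖∑ n ∈ s, β n * Complex.exp (Complex.I * μ n * t)‖ ^ 2 ∧
    ∫ t in (0 : ℝ)..S, Real.sin (Real.pi / S * t) *
        ‖∑ n ∈ s, β n * Complex.exp (Complex.I * μ n * t)‖ ^ 2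
      ≤ (2 / (Real.pi / S) * Real.exp (2 * d * S)
        + Real.pi / S * (1 + Real.exp (2 * d * S)) * (4 / g ^ 2)) * ∑ n ∈ s, ‖β n‖ ^ 2 := by
  set Q := ∫ t in (0 : ℝ)..S, Real.sin (Real.pi / S * t) *
        ‖∑ n ∈ s, β n * Complex.exp (Complex.I * μ n * t)‖ ^ 2 with hQ
  set c : ℝ := Real.pi / S * (1 + Real.exp (2 * d * S)) * (4 / g ^ 2) with hc
  have hc0 : 0 ≤ c := by positivity
  let J : ℂ → ℂ := fun l => ∫ t in (0 : ℝ)..S, (Real.sin (Real.pi / S * t) : ℂ) *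
            Complex.exp (Complex.I * l * t)
  let D : ℤ → ℝ := fun n => ∫ t in (0 : ℝ)..S, Real.sin (Real.pi / S * t) *
            Real.exp (-(2 * (μ n).im) * t)
  have hJD : ∀ n, J (μ n - (starRingEnd ℂ) (μ n)) = D n := by
    intro n
    simp only [J, D]
    rw [← intervalIntegral.integral_ofReal]
    congr 1
    ext t
    rw [Complex.sub_conj]
    push_cast
    congr 2
    linear_combination (2 * ((μ n).im : ℂ) * t) * Complex.I_sq
  have hdiff : |Q - ∑ n ∈ s, ‖β n‖ ^ 2 * D n| ≤ c * ∑ n ∈ s, ‖β n‖ ^ 2 := by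
    have hsplit : ((Q - ∑ n ∈ s, ‖β n‖ ^ 2 * D n : ℝ) : ℂ) = ∑ n ∈ s, ∑ m ∈ s,
        if n = m then 0 else β n * (starRingEnd ℂ) (β m) * J (μ n - (starRingEnd ℂ) (μ m)) := by
      rw [Complex.ofReal_sub, hQ, integral_sin_mul_normSq_sum_cexp, Complex.ofReal_sum,
        ← Finset.sum_sub_distrib]
      refine Finset.sum_congr rfl fun n hn => ?_
      rw [← Finset.add_sum_erase s _ hn, ← Finset.add_sum_erase s (fun m => ite _ _ _) hn,
        if_pos rfl]
      have h1 : β n * (starRingEnd ℂ) (β n) * J (μ n - (starRingEnd ℂ) (μ n))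
          = ((‖β n‖ ^ 2 * D n : ℝ) : ℂ) := by
        rw [hJD, Complex.mul_conj']
        push_cast
        rfl
      have h2 : ∑ m ∈ s.erase n, (if n = m then 0 else
          β n * (starRingEnd ℂ) (β m) * J (μ n - (starRingEnd ℂ) (μ m)))
          = ∑ m ∈ s.erase n, β n * (starRingEnd ℂ) (β m) * J (μ n - (starRingEnd ℂ) (μ m)) :=
        Finset.sum_congr rfl fun m hm => if_neg (Finset.ne_of_mem_erase hm).symm
      rw [h2]
      simp only [J] at h1 ⊢
      rw [h1]
      ring
    rw [← Real.norm_eq_abs, ← Complex.norm_real, hsplit]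
    calc _ ≤ ∑ n ∈ s, ∑ m ∈ s, c * (‖β n‖ * ‖β m‖ * inghamKernel (n - m)) := by
          refine norm_sum_le_of_le _ fun n hn => norm_sum_le_of_le _ fun m hm => ?_
          split_ifs with hnm
          · simp only [norm_zero]
            exact mul_nonneg hc0 (mul_nonneg (by positivity) (inghamKernel_nonneg _))
          · have hJ : ‖J (μ n - (starRingEnd ℂ) (μ m))‖ ≤ c * inghamKernel (n - m) := by
              refine norm_integral_sin_mul_cexp_le hS hg ?_ (sub_ne_zero.2 hnm) ?_
              · rw [Complex.sub_im, Complex.conj_im, sub_neg_eq_add]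
                exact (abs_add_le _ _).trans (by linarith [him n hn, him m hm])
              · rw [Complex.sub_re, Complex.conj_re]
                exact hre n hn m hm
            rw [norm_mul, norm_mul, Complex.norm_conj]
            calc _ ≤ ‖β n‖ * ‖β m‖ * (c * inghamKernel (n - m)) := by gcongr
              _ = _ := by ring
      _ ≤ _ := by
          simp_rw [← Finset.mul_sum]
          exact mul_le_mul_of_nonneg_left (sum_sum_mul_inghamKernel_le s fun n => ‖β n‖) hc0
  have hD : ∀ n ∈ s, 2 / (Real.pi / S) * Real.exp (-(2 * d * S)) ≤ D n ∧
      D n ≤ 2 / (Real.pi / S) * Real.exp (2 * d * S) := fun n hn =>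
    integral_sin_mul_exp_mem hS (by
      rw [abs_neg, abs_mul, abs_two]; linarith [him n hn])
  have hlow : 2 / (Real.pi / S) * Real.exp (-(2 * d * S)) * ∑ n ∈ s, ‖β n‖ ^ 2
      ≤ ∑ n ∈ s, ‖β n‖ ^ 2 * D n := by
    rw [Finset.mul_sum]
    refine Finset.sum_le_sum fun n hn => ?_
    rw [mul_comm]
    exact mul_le_mul_of_nonneg_left (hD n hn).1 (sq_nonneg _)
  have hup : ∑ n ∈ s, ‖β n‖ ^ 2 * D n
      ≤ 2 / (Real.pi / S) * Real.exp (2 * d * S) * ∑ n ∈ s, ‖β n‖ ^ 2 := by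
    rw [Finset.mul_sum]
    refine Finset.sum_le_sum fun n hn => ?_
    rw [mul_comm (2 / _ * _)]
    exact mul_le_mul_of_nonneg_left (hD n hn).2 (sq_nonneg _)
  have hdiff' := abs_le.1 hdiff
  constructor <;> nlinarith

/-- Direct and inverse inequalities of Ingham type for finite exponential sums. -/
lemma ingham_finset {T g d : ℝ} (hT : 0 < T) (hg : 2 * (Real.pi / T) < g)
    (s : Finset ℤ) (μ β : ℤ → ℂ) (him : ∀ n ∈ s, |(μ n).im| ≤ d)
    (hre : ∀ n ∈ s, ∀ m ∈ s, g * |((n - m : ℤ) : ℝ)| ≤ |(μ n).re - (μ m).re|) :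
    (2 / (Real.pi / T) * Real.exp (-(2 * d * T))
        - Real.pi / T * (1 + Real.exp (2 * d * T)) * (4 / g ^ 2)) * ∑ n ∈ s, ‖β n‖ ^ 2
      ≤ ∫ t in (0 : ℝ)..T, ‖∑ n ∈ s, β n * Complex.exp (Complex.I * μ n * t)‖ ^ 2 ∧
    ∫ t in (0 : ℝ)..T, ‖∑ n ∈ s, β n * Complex.exp (Complex.I * μ n * t)‖ ^ 2
      ≤ 2 * (2 / (Real.pi / (3 * T)) * Real.exp (2 * d * (3 * T))
        + Real.pi / (3 * T) * (1 + Real.exp (2 * d * (3 * T))) * (4 / g ^ 2)) *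
          Real.exp (d * T) ^ 2 * ∑ n ∈ s, ‖β n‖ ^ 2 := by
  constructor
  · refine (ingham_weighted hT hg s μ β him hre).1.trans ?_
    refine intervalIntegral.integral_mono_on hT.le (Continuous.intervalIntegrable (by fun_prop) _ _)
      (Continuous.intervalIntegrable (by fun_prop) _ _) fun t _ => ?_
    exact mul_le_of_le_one_left (sq_nonneg _) (Real.sin_le_one _)
  · have h3T : 0 < 3 * T := by positivity
    have haS : Real.pi / (3 * T) * (3 * T) = Real.pi := by field_simp
    have ha : 0 < Real.pi / (3 * T) := by positivity
    have hg3 : 2 * (Real.pi / (3 * T)) < g := by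
      have : Real.pi / (3 * T) ≤ Real.pi / T :=
        div_le_div_of_nonneg_left Real.pi_pos.le hT (by linarith)
      linarith
    let β' : ℤ → ℂ := fun n => β n * Complex.exp (Complex.I * (-μ n) * T)
    let F : ℝ → ℝ := fun t => ‖∑ n ∈ s, β' n * Complex.exp (Complex.I * μ n * t)‖ ^ 2
    have hFc : Continuous F := by fun_prop
    have hw := (ingham_weighted h3T hg3 s μ β' him hre).2
    have hβ' : ∑ n ∈ s, ‖β' n‖ ^ 2 ≤ Real.exp (d * T) ^ 2 * ∑ n ∈ s, ‖β n‖ ^ 2 := by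
      rw [Finset.mul_sum]
      refine Finset.sum_le_sum fun n hn => ?_
      have hn' : ‖Complex.exp (Complex.I * (-μ n) * T)‖ ≤ Real.exp (d * T) :=
        norm_cexp_I_mul_le (by simpa using him n hn) hT.le le_rfl
      simp only [β']
      rw [norm_mul, mul_pow, mul_comm]
      gcongr
    have hshift : ∫ t in (0 : ℝ)..T, ‖∑ n ∈ s, β n * Complex.exp (Complex.I * μ n * t)‖ ^ 2
        = ∫ t in T..2 * T, F t := by
      have h := intervalIntegral.integral_comp_add_right (a := 0) (b := T) F T
      rw [zero_add, ← two_mul] at h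
      rw [← h]
      congr 1
      ext t
      simp only [F, β']
      congr 2
      refine Finset.sum_congr rfl fun n _ => ?_
      rw [mul_assoc (β n), ← Complex.exp_add]
      push_cast
      ring_nf
    have hmid : ∫ t in T..2 * T, 1 / 2 * F t
        ≤ ∫ t in (0 : ℝ)..3 * T, Real.sin (Real.pi / (3 * T) * t) * F t := by
      have hint : ∀ a b, IntervalIntegrable (fun t => Real.sin (Real.pi / (3 * T) * t) * F t)
          volume a b := fun a b => Continuous.intervalIntegrable (by fun_prop) _ _
      have hmono := intervalIntegral.integral_mono_interval (μ := volume) (a := T) (b := 2 * T)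
        (c := 0) (d := 3 * T) hT.le (by linarith) (by linarith)
        (f := fun t => Real.sin (Real.pi / (3 * T) * t) * F t) ?_ (hint _ _)
      · refine le_trans ?_ hmono
        refine intervalIntegral.integral_mono_on (by linarith)
          (Continuous.intervalIntegrable (by fun_prop) _ _) (hint _ _) fun t ht => ?_
        refine mul_le_mul_of_nonneg_right ?_ (sq_nonneg _)
        have h1 : Real.pi / 3 ≤ Real.pi / (3 * T) * t := by
          have := mul_le_mul_of_nonneg_left ht.1 ha.le
          linarith
        have h2 : Real.pi / (3 * T) * t ≤ Real.pi - Real.pi / 3 := by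
          have := mul_le_mul_of_nonneg_left ht.2 ha.le
          linarith
        have hpi := Real.pi_pos
        rw [← Real.cos_sub_pi_div_two, ← Real.cos_abs, ← Real.cos_pi_div_three]
        refine Real.cos_le_cos_of_nonneg_of_le_pi (abs_nonneg _) (by linarith) ?_
        rw [abs_le]
        constructor <;> linarith
      · refine (ae_restrict_iff' measurableSet_Ioc).2 (ae_of_all _ fun t ht => ?_)
        refine mul_nonneg (Real.sin_nonneg_of_nonneg_of_le_pi (mul_nonneg ha.le ht.1.le) ?_)
          (sq_nonneg _)
        exact (mul_le_mul_of_nonneg_left ht.2 ha.le).trans_eq haS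
    rw [intervalIntegral.integral_const_mul, ← hshift] at hmid
    have hc : 0 ≤ 2 / (Real.pi / (3 * T)) * Real.exp (2 * d * (3 * T))
        + Real.pi / (3 * T) * (1 + Real.exp (2 * d * (3 * T))) * (4 / g ^ 2) := by positivity
    have hlast := mul_le_mul_of_nonneg_left hβ' hc
    have hchain := hmid.trans (hw.trans hlast)
    linarith

/-- A frequency gap on two half-lines gives, far out, a slightly smaller gap across both. -/
lemma exists_uniform_gap {γ g : ℝ} (hgγ : g < γ) (N0 : ℕ) (x : ℤ → ℝ)
    (hgap : ∀ n : ℤ, (N0 : ℤ) ≤ |n| → x (n + 1) - x n ≥ γ) :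
    ∃ M : ℕ, N0 ≤ M ∧ ∀ n m : ℤ, (M : ℤ) ≤ |n| → (M : ℤ) ≤ |m| →
      g * |((n - m : ℤ) : ℝ)| ≤ |x n - x m| := by
  have hpos : ∀ m n : ℤ, m ≤ n → (N0 : ℤ) ≤ m → γ * ((n : ℝ) - m) ≤ x n - x m := by
    intro m n hmn hm
    induction n, hmn using Int.leInduction with
    | base => simp
    | succ n hn ih =>
      have h := hgap n (by rw [abs_of_nonneg (by omega)]; omega)
      push_cast
      linarith
  have hneg : ∀ m n : ℤ, m ≤ n → n ≤ -(N0 : ℤ) → γ * ((n : ℝ) - m) ≤ x n - x m := by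
    intro m n hmn
    induction n, hmn using Int.leInduction with
    | base => simp
    | succ n hn ih =>
      intro hn'
      have h := hgap n (by rw [abs_of_nonpos (by omega)]; omega)
      have := ih (by omega)
      push_cast
      linarith
  obtain ⟨K, hK⟩ := exists_nat_ge
    ((2 * γ * N0 + x (-(N0 : ℤ)) - x N0) / (γ - g))
  have hγg : 0 < γ - g := sub_pos.2 hgγ
  rw [div_le_iff₀ hγg] at hK
  refine ⟨max N0 K, le_max_left _ _, ?_⟩
  have key : ∀ m n : ℤ, m ≤ n → ((max N0 K : ℕ) : ℤ) ≤ |n| → ((max N0 K : ℕ) : ℤ) ≤ |m| →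
      g * ((n : ℝ) - m) ≤ x n - x m := by
    intro m n hmn hn hm
    have hmn' : (0 : ℝ) ≤ (n : ℝ) - m := sub_nonneg.2 (by exact_mod_cast hmn)
    have hle : g * ((n : ℝ) - m) ≤ γ * ((n : ℝ) - m) :=
      mul_le_mul_of_nonneg_right hgγ.le hmn'
    rcases le_abs'.1 hn with hn' | hn'
    · exact hle.trans (hneg m n hmn (by omega))
    rcases le_abs'.1 hm with hm' | hm'
    · have h1 := hpos N0 n (by omega) le_rfl
      have h2 := hneg m (-(N0 : ℤ)) (by omega) le_rfl
      have hKn : (K : ℝ) ≤ (n : ℝ) - m := by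
        have : (K : ℤ) ≤ n - m := by omega
        exact_mod_cast this
      have h3 := mul_le_mul_of_nonneg_right hKn hγg.le
      push_cast at h1 h2
      linarith
    · exact hle.trans (hpos m n hmn (by omega))
  intro n m hn hm
  rcases le_total m n with h | h
  · have h0 : (0 : ℝ) ≤ ((n - m : ℤ) : ℝ) := by exact_mod_cast sub_nonneg.2 h
    rw [abs_of_nonneg h0]
    push_cast
    exact (key m n h hn hm).trans (le_abs_self _)
  · have h0 : (0 : ℝ) ≤ ((m - n : ℤ) : ℝ) := by exact_mod_cast sub_nonneg.2 h
    rw [← neg_sub, Int.cast_neg, abs_neg, abs_of_nonneg h0, abs_sub_comm]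
    push_cast
    exact (key n m h hm hn).trans (le_abs_self _)

lemma exists_pos_ingham_const {T g : ℝ} (hT : 0 < T) (hg : 2 * (Real.pi / T) < g) :
    ∃ d > 0, 0 < 2 / (Real.pi / T) * Real.exp (-(2 * d * T))
        - Real.pi / T * (1 + Real.exp (2 * d * T)) * (4 / g ^ 2) := by
  have hcont : Continuous fun d : ℝ => 2 / (Real.pi / T) * Real.exp (-(2 * d * T))
        - Real.pi / T * (1 + Real.exp (2 * d * T)) * (4 / g ^ 2) := by fun_prop
  have ha : 0 < Real.pi / T := div_pos Real.pi_pos hT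
  have h0 : 0 < 2 / (Real.pi / T) * Real.exp (-(2 * 0 * T))
        - Real.pi / T * (1 + Real.exp (2 * 0 * T)) * (4 / g ^ 2) := by
    simp only [mul_zero, zero_mul, neg_zero, Real.exp_zero, mul_one]
    generalize Real.pi / T = a at *
    have hg0 : 0 < g := by linarith
    have h : 2 / a - a * (1 + 1) * (4 / g ^ 2) = 2 * (g ^ 2 - (2 * a) ^ 2) / (a * g ^ 2) := by
      field_simp
      ring
    rw [h]
    have : (2 * a) ^ 2 < g ^ 2 := by gcongr
    have : 0 < g ^ 2 - (2 * a) ^ 2 := by linarith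
    positivity
  have hev := hcont.continuousAt.eventually (lt_mem_nhds h0)
  obtain ⟨d, hd, hd'⟩ := ((hev.filter_mono nhdsWithin_le_nhds).and
    (self_mem_nhdsWithin (s := Set.Ioi (0 : ℝ)))).exists
  exact ⟨d, hd', hd⟩

/-- The `L²` norms of the partial sums of an absolutely convergent exponential series with
frequencies in a horizontal strip converge to the `L²` norm of its sum. -/
lemma tendsto_integral_normSq_sum_cexp {T d : ℝ} (hT : 0 ≤ T) (μ β : ℤ → ℂ)
    (hβ : Summable fun n => ‖β n‖) (him : ∀ n, β n ≠ 0 → |(μ n).im| ≤ d) (g : ℝ → ℂ)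
    (hg : ∀ t : ℝ, HasSum (fun n : ℤ => β n * Complex.exp (Complex.I * μ n * t)) (g t)) :
    Tendsto (fun s : Finset ℤ => ∫ t in (0 : ℝ)..T,
        ‖∑ n ∈ s, β n * Complex.exp (Complex.I * μ n * t)‖ ^ 2) atTop
      (nhds (∫ t in (0 : ℝ)..T, ‖g t‖ ^ 2)) := by
  refine intervalIntegral.tendsto_integral_filter_of_dominated_convergence
    (fun _ => ((∑' n, ‖β n‖) * Real.exp (d * T)) ^ 2) ?_ ?_ ?_ ?_
  · refine Eventually.of_forall fun s => Continuous.aestronglyMeasurable (by fun_prop)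
  · refine Eventually.of_forall fun s => ae_of_all _ fun t ht => ?_
    rw [Set.uIoc_of_le hT] at ht
    rw [norm_pow, norm_norm]
    gcongr
    calc _ ≤ ∑ n ∈ s, ‖β n‖ * Real.exp (d * T) := by
          refine norm_sum_le_of_le _ fun n _ => ?_
          rw [norm_mul]
          by_cases h : β n = 0
          · simp [h]
          · gcongr
            exact norm_cexp_I_mul_le (him n h) ht.1.le ht.2
      _ ≤ _ := by
          rw [← Finset.sum_mul]
          gcongr
          exact hβ.sum_le_tsum s fun n _ => norm_nonneg _
  · exact intervalIntegrable_const
  · exact ae_of_all _ fun t _ => ((hg t).norm).pow 2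

/-- Ingham-type inequality for complex frequencies `μ_n` (`|n| ≥ N₀`) with gap
`Re μ_{n+1} - Re μ_n ≥ γ` and `Im μ_n → 0` as `|n| → ∞`: for `T > 2π/γ` there are
`M ≥ N₀` and constants `C, C₁ > 0` such that for any square-summable `(β_n)_{|n| ≥ M}`,
`C ∑ |β_n|² ≤ ∫₀^T |∑ β_n e^{iμ_n t}|² dt ≤ C₁ ∑ |β_n|²`. -/
theorem stmt_17 (γ T : ℝ) (hγ : 0 < γ) (hT : 2 * Real.pi / γ < T) (N0 : ℕ)
    (μ : ℤ → ℂ)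
    (hgap : ∀ n : ℤ, (N0 : ℤ) ≤ |n| → (μ (n+1)).re - (μ n).re ≥ γ)
    (him : Tendsto (fun n : ℤ => (μ n).im) cofinite (nhds 0)) :
    ∃ M : ℕ, N0 ≤ M ∧ ∃ C > 0, ∃ C1 > 0,
      ∀ β : ℤ → ℂ, Summable (fun n => ‖β n‖^2) →
        (∀ n : ℤ, |n| < (M:ℤ) → β n = 0) →
        ∀ g : ℝ → ℂ,
          (∀ t : ℝ, HasSum (fun n : ℤ => β n * Complex.exp (Complex.I * μ n * t)) (g t)) →
          C * (∑' n : ℤ, ‖β n‖^2) ≤ (∫ t in (0:ℝ)..T, ‖g t‖^2) ∧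
          (∫ t in (0:ℝ)..T, ‖g t‖^2) ≤ C1 * (∑' n : ℤ, ‖β n‖^2) := by
  have hpi := Real.pi_pos
  have hT0 : 0 < T := lt_trans (by positivity) hT
  have hγT : 2 * (Real.pi / T) < γ := by
    rw [← mul_div_assoc, div_lt_iff₀ hT0]
    rwa [div_lt_iff₀ hγ, mul_comm T] at hT
  obtain ⟨r, hr, hrγ⟩ := exists_between hγT
  have hr0 : 0 < r := lt_trans (by positivity) hr
  obtain ⟨d, hd, hC⟩ := exists_pos_ingham_const hT0 hr
  obtain ⟨M₁, hM₁, hgapM⟩ := exists_uniform_gap hrγ N0 (fun n => (μ n).re) hgap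
  obtain ⟨M₂, hM₂⟩ : ∃ M₂ : ℕ, ∀ n : ℤ, (M₂ : ℤ) ≤ |n| → |(μ n).im| ≤ d := by
    have hfin : {n : ℤ | ¬ |(μ n).im| ≤ d}.Finite := by
      have h := him.eventually (Metric.closedBall_mem_nhds (0 : ℝ) hd)
      simp only [Real.dist_eq, sub_zero] at h
      exact eventually_cofinite.1 h
    obtain ⟨K, hK⟩ := (hfin.image Int.natAbs).bddAbove
    refine ⟨K + 1, fun n hn => ?_⟩
    by_contra h
    have : n.natAbs ≤ K := hK (Set.mem_image_of_mem Int.natAbs h)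
    rw [Int.abs_eq_natAbs] at hn
    omega
  refine ⟨max M₁ M₂, hM₁.trans (le_max_left _ _), _, hC,
    2 * (2 / (Real.pi / (3 * T)) * Real.exp (2 * d * (3 * T))
        + Real.pi / (3 * T) * (1 + Real.exp (2 * d * (3 * T))) * (4 / r ^ 2)) *
          Real.exp (d * T) ^ 2, by positivity, ?_⟩
  intro β hβ hβ0 g hg
  have hlarge : ∀ n, β n ≠ 0 → ((max M₁ M₂ : ℕ) : ℤ) ≤ |n| := fun n hn =>
    not_lt.1 fun h => hn (hβ0 n h)
  have hsummable : Summable fun n => ‖β n‖ := by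
    have h := (hg 0).summable.norm
    simpa using h
  have hlim := tendsto_integral_normSq_sum_cexp hT0.le μ β hsummable
    (fun n hn => hM₂ n (by have := hlarge n hn; omega)) g hg
  have hsum := hβ.hasSum
  have hfinset := fun s : Finset ℤ => ingham_finset hT0 hr (s.filter fun n => β n ≠ 0) μ β
    (fun n hn => hM₂ n (by have := hlarge n (Finset.mem_filter.1 hn).2; omega))
    (fun n hn m hm => hgapM n m (by have := hlarge n (Finset.mem_filter.1 hn).2; omega)
      (by have := hlarge m (Finset.mem_filter.1 hm).2; omega))
  have hsq : ∀ s : Finset ℤ, ∑ n ∈ s.filter (fun n => β n ≠ 0), ‖β n‖ ^ 2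
      = ∑ n ∈ s, ‖β n‖ ^ 2 := fun s =>
    Finset.sum_filter_of_ne fun n _ h h0 => h (by simp [h0])
  have hexp : ∀ (s : Finset ℤ) (t : ℝ),
      ∑ n ∈ s.filter (fun n => β n ≠ 0), β n * Complex.exp (Complex.I * μ n * t)
      = ∑ n ∈ s, β n * Complex.exp (Complex.I * μ n * t) := fun s t =>
    Finset.sum_filter_of_ne fun n _ h h0 => h (by simp [h0])
  simp only [hsq, hexp] at hfinset
  exact ⟨le_of_tendsto_of_tendsto' (hsum.const_mul _) hlim fun s => (hfinset s).1,
    le_of_tendsto_of_tendsto' hlim (hsum.const_mul _) fun s => (hfinset s).2⟩
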